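/- Let A be an abelian algebra and θ a congruence on A. Let A(θ) be the substructure of A × A whose universe is {(x,y) | x θ y}, let D = {(c,c) | c ∈ A} be the diagonal, and let Δ be the smallest congruence of A(θ) containing D × D. Then D is a single Δ-class: for every (x,y) ∈ A(θ) and every c ∈ A, if ((x,y),(c,c)) ∈ Δ then x = y. -/

import Mathlib

namespace UA

/-- An algebraic language: a type of operation symbols with arities. -/
structure Lang where
  F : Type
  arity : F → ℕ

variable {L : Lang}

/-- An interpretation of the language `L` on the carrier `A` (an algebra structure). -/
def Interp (L : Lang) (A : Type) : Type :=
  (f : L.F) → ((Fin (L.arity f)) → A) → A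

/-- Terms of the language `L` over a type `X` of variables. -/
inductive Term (L : Lang) (X : Type) : Type
  | var : X → Term L X
  | app : (f : L.F) → ((Fin (L.arity f)) → Term L X) → Term L X

/-- Realization of a term under an assignment of the variables. -/
def Term.realize {A X : Type} (I : Interp L A) (v : X → A) : Term L X → A
  | .var x => v x
  | .app f ts => I f (fun i => (ts i).realize I v)

/-- Relabelling (substitution of variables) of terms. -/
def Term.relabel {X Y : Type} (g : X → Y) : Term L X → Term L Y
  | .var x => .var (g x)
  | .app f ts => .app f (fun i => (ts i).relabel g)

/-- `p` is a polynomial operation of the algebra `(A, I)` with argument-index type `X`: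
it is the realization of a term in variables `X ⊕ Fin m` where the `Fin m` variables
are evaluated at fixed constants. -/
def IsPolyOp {A X : Type} (I : Interp L A) (p : (X → A) → A) : Prop :=
  ∃ (m : ℕ) (t : Term L (X ⊕ Fin m)) (c : Fin m → A),
    ∀ x : X → A, p x = t.realize I (Sum.elim x c)

/-- A unary polynomial operation. -/
def IsUnaryPolyOp {A : Type} (I : Interp L A) (g : A → A) : Prop :=
  IsPolyOp I (fun x : Fin 1 → A => g (x 0))

/-- `(p, q, r, s)` is a `1,1`-matrix of the algebra `(A, I)`. -/
def Is11Matrix {A : Type} (I : Interp L A) (p q r s : A) : Prop :=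
  ∃ (k l : ℕ) (t : ((Fin k ⊕ Fin l) → A) → A), IsPolyOp I t ∧
    ∃ (a b : Fin k → A) (u v : Fin l → A),
      p = t (Sum.elim a u) ∧ q = t (Sum.elim a v) ∧
      r = t (Sum.elim b u) ∧ s = t (Sum.elim b v)

/-- The algebra is abelian: in every `1,1`-matrix, `p = q` implies `r = s`. -/
def IsAbelian {A : Type} (I : Interp L A) : Prop :=
  ∀ p q r s : A, Is11Matrix I p q r s → p = q → r = s

/-- The algebra is strongly rectangular: in every `1,1`-matrix, `q = r` implies `r = s`. -/
def IsStronglyRectangular {A : Type} (I : Interp L A) : Prop :=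
  ∀ p q r s : A, Is11Matrix I p q r s → q = r → r = s

/-- Strongly abelian = abelian + strongly rectangular. -/
def IsStronglyAbelian {A : Type} (I : Interp L A) : Prop :=
  IsAbelian I ∧ IsStronglyRectangular I

/-- The algebra has a Maltsev polynomial operation. -/
def HasMaltsevPoly {A : Type} (I : Interp L A) : Prop :=
  ∃ mOp : (Fin 3 → A) → A, IsPolyOp I mOp ∧
    ∀ x y : A, mOp ![x, y, y] = x ∧ mOp ![y, y, x] = x

/-- Affine = abelian + has a Maltsev polynomial operation. -/
def IsAffine {A : Type} (I : Interp L A) : Prop :=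
  IsAbelian I ∧ HasMaltsevPoly I

/-- The algebra satisfies the identity `e.1 ≈ e.2`. -/
def Satisfies {A : Type} (I : Interp L A) (e : Term L ℕ × Term L ℕ) : Prop :=
  ∀ v : ℕ → A, e.1.realize I v = e.2.realize I v

/-- Membership in the variety `Mod(E)` axiomatized by the set `E` of identities. -/
def InVariety {A : Type} (E : Set (Term L ℕ × Term L ℕ)) (I : Interp L A) : Prop :=
  ∀ e ∈ E, Satisfies I e

/-- `θ` is a congruence on the algebra `(A, I)`. -/
def IsCong {A : Type} (I : Interp L A) (θ : A → A → Prop) : Prop :=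
  Equivalence θ ∧
    ∀ (f : L.F) (a b : Fin (L.arity f) → A),
      (∀ i, θ (a i) (b i)) → θ (I f a) (I f b)

/-- `(p, q, r, s)` is a `θ`-matrix of the algebra `(A, I)`. -/
def IsThetaMatrix {A : Type} (I : Interp L A) (θ : A → A → Prop) (p q r s : A) : Prop :=
  ∃ (k l : ℕ) (t : ((Fin k ⊕ Fin l) → A) → A), IsPolyOp I t ∧
    ∃ (a b : Fin k → A) (u v : Fin l → A),
      (∀ i, θ (a i) (b i)) ∧ (∀ j, θ (u j) (v j)) ∧
      p = t (Sum.elim a u) ∧ q = t (Sum.elim a v) ∧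
      r = t (Sum.elim b u) ∧ s = t (Sum.elim b v)

/-- `θ` is a strongly abelian congruence. -/
def IsStronglyAbelianCong {A : Type} (I : Interp L A) (θ : A → A → Prop) : Prop :=
  ∀ p q r s : A, IsThetaMatrix I θ p q r s → (p = q → r = s) ∧ (q = r → r = s)

/-- `S` is a subuniverse of the algebra `(A, I)`. -/
def IsSubuniverse {A : Type} (I : Interp L A) (S : Set A) : Prop :=
  ∀ (f : L.F) (a : Fin (L.arity f) → A), (∀ i, a i ∈ S) → I f a ∈ S

/-- The substructure (restricted algebra structure) on a subuniverse. -/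
def subInterp {A : Type} (I : Interp L A) (S : Set A) (hS : IsSubuniverse I S) :
    Interp L S :=
  fun f a => ⟨I f (fun i => (a i : A)), hS f _ (fun i => (a i).2)⟩

/-- The componentwise algebra structure on a product. -/
def prodInterp {ι : Type} {A : ι → Type} (I : ∀ i, Interp L (A i)) :
    Interp L (∀ i, A i) :=
  fun f a i => I i f (fun j => a j i)

/-- The componentwise algebra structure on `A × A`. -/
def pairInterp {A : Type} (I : Interp L A) : Interp L (A × A) :=
  fun f a => (I f (fun i => (a i).1), I f (fun i => (a i).2))

/-- `h` is a homomorphism of `L`-algebras. -/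
def IsHom {A B : Type} (I : Interp L A) (J : Interp L B) (h : A → B) : Prop :=
  ∀ (f : L.F) (a : Fin (L.arity f) → A), h (I f a) = J f (fun i => h (a i))

/-- The induced algebra structure on the quotient by a congruence `ρ`
(well-defined, i.e. independent of the chosen representatives, when `ρ` is a congruence). -/
noncomputable def quotInterp {A : Type} (I : Interp L A) (ρ : A → A → Prop) :
    Interp L (Quot ρ) :=
  fun f a => Quot.mk ρ (I f (fun i => (a i).out))

/-- The subuniverse generated by a subset `G`: the intersection of all
subuniverses containing `G`. -/
def GenSub {A : Type} (I : Interp L A) (G : Set A) : Set A :=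
  {x | ∀ S : Set A, IsSubuniverse I S → G ⊆ S → x ∈ S}

theorem genSub_isSubuniverse {A : Type} (I : Interp L A) (G : Set A) :
    IsSubuniverse I (GenSub I G) :=
  fun f a ha S hS hG => hS f a (fun i => ha i S hS hG)

/-- The smallest congruence containing the pair `(x, y)`: the intersection of all
congruences containing it. -/
def genCong {A : Type} (I : Interp L A) (x y : A) : A → A → Prop :=
  fun w z => ∀ ρ : A → A → Prop, IsCong I ρ → ρ x y → ρ w z

/-- The carrier of `A(θ)`, the graph of `θ` inside `A × A`. -/
abbrev ThetaSub {A : Type} (θ : A → A → Prop) : Type := {z : A × A // θ z.1 z.2}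

/-- The substructure `A(θ) ≤ A × A` supported by the graph of `θ`. -/
def thetaSubInterp {A : Type} (I : Interp L A) (θ : A → A → Prop) (hθ : IsCong I θ) :
    Interp L (ThetaSub θ) :=
  fun f a => ⟨(I f (fun i => (a i).1.1), I f (fun i => (a i).1.2)),
    hθ.2 f _ _ (fun i => (a i).2)⟩

/-- The diagonal element `(c, c)` of `A(θ)`. -/
def diagEl {A : Type} {θ : A → A → Prop} (hrefl : ∀ a : A, θ a a) (c : A) :
    ThetaSub θ := ⟨(c, c), hrefl c⟩

/-- `Δ`: the smallest congruence of `A(θ)` containing `D × D`, where `D` is the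
diagonal -- the intersection of all congruences of `A(θ)` containing `D × D`. -/
def DeltaRel {A : Type} (I : Interp L A) (θ : A → A → Prop) (hθ : IsCong I θ) :
    ThetaSub θ → ThetaSub θ → Prop :=
  fun x y => ∀ ρ : ThetaSub θ → ThetaSub θ → Prop,
    IsCong (thetaSubInterp I θ hθ) ρ →
    (∀ c d : A, ρ (diagEl hθ.1.refl c) (diagEl hθ.1.refl d)) → ρ x y

/-- The quotient algebra `S = A(θ)/Δ`. -/
noncomputable def SInterp {A : Type} (I : Interp L A) (θ : A → A → Prop)
    (hθ : IsCong I θ) : Interp L (Quot (DeltaRel I θ hθ)) :=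
  quotInterp (thetaSubInterp I θ hθ) (DeltaRel I θ hθ)

/-- The element `0` of `S = A(θ)/Δ`: the `Δ`-class of a diagonal element. -/
def zeroS {A : Type} (I : Interp L A) (θ : A → A → Prop) (hθ : IsCong I θ) (d : A) :
    Quot (DeltaRel I θ hθ) :=
  Quot.mk _ (diagEl hθ.1.refl d)

/-- The diagonal of `B × B`. -/
def diagSet (B : Type) : Set (B × B) := {z | z.1 = z.2}

/-- The set of pairs `(u j, v j)`. -/
def pairsSet {B : Type} {l : ℕ} (u v : Fin l → B) : Set (B × B) :=
  {z | ∃ j, z = (u j, v j)}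

/-- The carrier of the subalgebra `C ≤ B × B` generated by the diagonal and the
pairs `(u j, v j)`. -/
def CsetOf {L : Lang} {B : Type} (I : Interp L B) {l : ℕ} (u v : Fin l → B) :
    Set (B × B) :=
  GenSub (pairInterp I) (diagSet B ∪ pairsSet u v)

/-- The subalgebra `C ≤ B × B` generated by the diagonal and the pairs `(u j, v j)`. -/
def CInterpOf {L : Lang} {B : Type} (I : Interp L B) {l : ℕ} (u v : Fin l → B) :
    Interp L (CsetOf I u v) :=
  subInterp (pairInterp I) _ (genSub_isSubuniverse _ _)


/-- Simultaneous substitution of terms for variables. -/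
def Term.subst {X Y : Type} (g : X → Term L Y) : Term L X → Term L Y
  | .var x => g x
  | .app f ts => .app f (fun i => (ts i).subst g)

theorem Term.realize_subst {A X Y : Type} (I : Interp L A) (g : X → Term L Y) (v : Y → A)
    (t : Term L X) :
    (t.subst g).realize I v = t.realize I (fun x => (g x).realize I v) := by
  induction t with
  | var x => rfl
  | app f ts ih => simp only [Term.subst, Term.realize, ih]

theorem Term.realize_relabel {A X Y : Type} (I : Interp L A) (g : X → Y) (v : Y → A)
    (t : Term L X) : (t.relabel g).realize I v = t.realize I (v ∘ g) := by
  induction t with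
  | var x => rfl
  | app f ts ih => simp only [Term.relabel, Term.realize, ih]

theorem IsHom.map_realize {A B X : Type} {I : Interp L A} {J : Interp L B} {h : A → B}
    (hh : IsHom I J h) (v : X → A) (t : Term L X) :
    h (t.realize I v) = t.realize J (h ∘ v) := by
  induction t with
  | var x => rfl
  | app f ts ih => simp only [Term.realize, hh f, ih]

/-- The syntactic congruence of a set `D`: two elements are related when no polynomial
operation in one variable separates them with respect to membership in `D`. It is the largest
congruence for which `D` is a union of classes. -/
def syntacticCong {B : Type} (J : Interp L B) (D : Set B) (x y : B) : Prop :=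
  ∀ (X : Type) [Finite X] [DecidableEq X] (t : Term L X) (w : X → B) (i : X),
    t.realize J (Function.update w i x) ∈ D ↔ t.realize J (Function.update w i y) ∈ D

theorem syntacticCong.mem_iff {B : Type} {J : Interp L B} {D : Set B} {x y : B}
    (h : syntacticCong J D x y) : x ∈ D ↔ y ∈ D := by
  simpa [Term.realize] using h Unit (.var ()) (fun _ => x) ()

/-- Replacing finitely many arguments by related ones preserves membership in `D`. -/
theorem syntacticCong.realize_mem_iff {B X Y : Type} [Finite X] [Finite Y] {J : Interp L B}
    {D : Set B} {a b : Y → B} (h : ∀ i, syntacticCong J D (a i) (b i))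
    (t : Term L (X ⊕ Y)) (w : X → B) :
    t.realize J (Sum.elim w a) ∈ D ↔ t.realize J (Sum.elim w b) ∈ D := by
  classical
  have := Fintype.ofFinite Y
  suffices H : ∀ s : Finset Y, t.realize J (Sum.elim w a) ∈ D ↔
      t.realize J (Sum.elim w (s.piecewise b a)) ∈ D by
    simpa using H Finset.univ
  intro s
  induction s using Finset.induction_on with
  | empty => simp
  | insert i s hi ih =>
    have key := h i (X ⊕ Y) t (Sum.elim w (s.piecewise b a)) (Sum.inr i)
    have hai : Function.update (s.piecewise b a) i (a i) = s.piecewise b a := by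
      rw [Function.update_eq_self_iff, Finset.piecewise_eq_of_notMem _ _ _ hi]
    rw [← Sum.elim_update_right, ← Sum.elim_update_right, hai] at key
    rw [Finset.piecewise_insert, ih, key]

theorem syntacticCong_isCong {B : Type} (J : Interp L B) (D : Set B) :
    IsCong J (syntacticCong J D) := by
  refine ⟨⟨fun _ _ _ _ _ _ _ => Iff.rfl, fun h X _ _ t w i => (h X t w i).symm,
    fun h h' X _ _ t w i => (h X t w i).trans (h' X t w i)⟩, ?_⟩
  intro f a b hab X _ _ t w i
  let g : X → Term L (X ⊕ Fin (L.arity f)) :=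
    Function.update (fun x => .var (.inl x)) i (.app f fun j => .var (.inr j))
  have hg (c : Fin (L.arity f) → B) :
      (fun x => (g x).realize J (Sum.elim w c)) = Function.update w i (J f c) := by
    funext x
    by_cases hx : x = i
    · subst hx
      simp [g, Term.realize]
    · simp [g, hx, Term.realize]
  have key := syntacticCong.realize_mem_iff hab (t.subst g) w
  rwa [Term.realize_subst, Term.realize_subst, hg, hg] at key

/-- The term condition for abelian algebras, for terms in an arbitrary finite set of variables. -/
theorem IsAbelian.realize_update {A X : Type} [Finite X] [DecidableEq X] {I : Interp L A}
    (hA : IsAbelian I) (t : Term L X) (u v : X → A) (i : X) (c d : A)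
    (h : t.realize I (Function.update u i c) = t.realize I (Function.update v i c)) :
    t.realize I (Function.update u i d) = t.realize I (Function.update v i d) := by
  obtain ⟨n, ⟨e⟩⟩ := Finite.exists_equiv_fin X
  let g : X → Fin 1 ⊕ Fin n := Function.update (fun x => .inr (e x)) i (.inl 0)
  have hg (a : A) (w : X → A) :
      Sum.elim (fun _ => a) (w ∘ e.symm) ∘ g = Function.update w i a := by
    funext x
    by_cases hx : x = i
    · subst hx
      simp [g]
    · simp [g, hx]
  refine hA _ _ _ _ ⟨1, n, fun x => t.realize I (x ∘ g),
    ⟨0, t.relabel (Sum.inl ∘ g), Fin.elim0, fun x => ?_⟩,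
    fun _ => c, fun _ => d, u ∘ e.symm, v ∘ e.symm, ?_, ?_, ?_, ?_⟩ h
  · rw [Term.realize_relabel, ← Function.comp_assoc, Sum.elim_comp_inl]
  all_goals simp only [hg]

/-- For an abelian algebra `A` and a congruence `θ`, the diagonal `D` is a
single class of the smallest congruence `Δ` of `A(θ)` containing `D × D`: any element of
`A(θ)` that is `Δ`-related to a diagonal element is itself diagonal. -/
theorem statement4 {L : Lang} {A : Type} (I : Interp L A) (hA : IsAbelian I)
    (θ : A → A → Prop) (hθ : IsCong I θ) :
    ∀ (z : ThetaSub θ) (c : A),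
      DeltaRel I θ hθ z (diagEl hθ.1.refl c) → z.1.1 = z.1.2 := by
  intro z c h
  let J := thetaSubInterp I θ hθ
  let D : Set (ThetaSub θ) := {z | z.1.1 = z.1.2}
  have hfst : IsHom J I (fun z => z.1.1) := fun _ _ => rfl
  have hsnd : IsHom J I (fun z => z.1.2) := fun _ _ => rfl
  have move (X : Type) [Finite X] [DecidableEq X] (t : Term L X) (w : X → ThetaSub θ)
      (i : X) (c d : A)
      (hc : t.realize J (Function.update w i (diagEl hθ.1.refl c)) ∈ D) :
      t.realize J (Function.update w i (diagEl hθ.1.refl d)) ∈ D := by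
    simp only [D, Set.mem_ofPred_eq, hfst.map_realize, hsnd.map_realize,
      Function.comp_update] at hc ⊢
    exact hA.realize_update t _ _ i c d hc
  exact (h (syntacticCong J D) (syntacticCong_isCong J D)
    fun c d X _ _ t w i => ⟨move X t w i c d, move X t w i d c⟩).mem_iff.mpr rfl

end UA
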